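/- Let Q be any probability measure on Ξ, let ρ > m_c, and set λ_up := 2‖F‖∞/(ρ − m_c). Then for every f ∈ F, inf_{λ ∈ [0, ∞)} { λρ + E_{ξ∼Q}[φ^{τ,ε}(λ, f, ξ)] } = inf_{λ ∈ [0, λ_up)} { λρ + E_{ξ∼Q}[φ^{τ,ε}(λ, f, ξ)] }. -/

import Mathlib

open MeasureTheory Filter Set
open scoped ENNReal NNReal

noncomputable section

/-- The `t`-packing number of `F` for the uniform norm: the maximal cardinality of a
subset of `F` whose elements are pairwise at distance at least `t`. -/
def packingNum {Ξ : Type*} [TopologicalSpace Ξ] [CompactSpace Ξ]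
    (F : Set C(Ξ, ℝ)) (t : ℝ) : ℝ≥0∞ :=
  ⨆ (s : Finset C(Ξ, ℝ)) (_ : ↑s ⊆ F ∧ (s : Set C(Ξ, ℝ)).Pairwise fun f g => t ≤ dist f g),
    (s.card : ℝ≥0∞)

/-- Dudley's entropy integral of `F`. -/
def dudleyEntropy {Ξ : Type*} [TopologicalSpace Ξ] [CompactSpace Ξ] (F : Set C(Ξ, ℝ)) : ℝ :=
  ∫ t in Ioi (0 : ℝ), Real.sqrt (Real.log ((packingNum F t).toReal))

/-- `‖F‖∞ = sup_{f ∈ F} ‖f‖∞`. -/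
def supNormF {Ξ : Type*} [TopologicalSpace Ξ] [CompactSpace Ξ] (F : Set C(Ξ, ℝ)) : ℝ :=
  ⨆ f : F, ‖(f : C(Ξ, ℝ))‖

/-- Optimal transport cost `W_c(Q, Q')`. -/
def transportCost {Ξ : Type*} [MeasurableSpace Ξ] (c : Ξ → Ξ → ℝ) (Q Q' : Measure Ξ) : ℝ :=
  sInf { r | ∃ π : Measure (Ξ × Ξ), IsProbabilityMeasure π ∧
    π.map Prod.fst = Q ∧ π.map Prod.snd = Q' ∧ r = ∫ p, c p.1 p.2 ∂π }

/-- The Wasserstein robust risk `R_{ρ,Q}(f)`. -/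
def robustRisk {Ξ : Type*} [MeasurableSpace Ξ] (c : Ξ → Ξ → ℝ) (ρ : ℝ)
    (Q : Measure Ξ) (f : Ξ → ℝ) : ℝ :=
  sSup { r | ∃ Q' : Measure Ξ, IsProbabilityMeasure Q' ∧ transportCost c Q Q' ≤ ρ ∧
    r = ∫ ξ, f ξ ∂Q' }

/-- Empirical measure `P̂_n` of a sample `ω`. -/
def empiricalMeasure {Ξ : Type*} [MeasurableSpace Ξ] (n : ℕ) (ω : Fin n → Ξ) : Measure Ξ :=
  (n : ℝ≥0∞)⁻¹ • ∑ i : Fin n, Measure.dirac (ω i)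

/-- Set of maximizers of `f` over `Ξ`. -/
def argmaxSet {Ξ : Type*} [TopologicalSpace Ξ] (f : C(Ξ, ℝ)) : Set Ξ := {ζ | ∀ ξ, f ξ ≤ f ζ}

/-- The critical radius `ρ_crit`. -/
def rhoCrit {Ξ : Type*} [TopologicalSpace Ξ] [MeasurableSpace Ξ]
    (c : Ξ → Ξ → ℝ) (P : Measure Ξ) (F : Set C(Ξ, ℝ)) : ℝ :=
  ⨅ f : F, ∫ ξ, sInf (c ξ '' argmaxSet (f : C(Ξ, ℝ))) ∂P

/-- The maximal radius `ρ_max(λ)`. -/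
def rhoMax {Ξ : Type*} [TopologicalSpace Ξ] [MeasurableSpace Ξ]
    (c : Ξ → Ξ → ℝ) (P : Measure Ξ) (F : Set C(Ξ, ℝ)) (lam : ℝ) : ℝ :=
  ⨅ f : F, ∫ ξ,
    sInf (c ξ '' {ζ | ∀ ζ', (f : C(Ξ, ℝ)) ζ' - lam * c ξ ζ' ≤ (f : C(Ξ, ℝ)) ζ - lam * c ξ ζ}) ∂P

/-- The dual generator `φ(λ, f, ξ) = sup_ζ (f(ζ) - λ c(ξ, ζ))`. -/
def dualGen {Ξ : Type*} (c : Ξ → Ξ → ℝ) (lam : ℝ) (f : Ξ → ℝ) (ξ : Ξ) : ℝ :=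
  ⨆ ζ, (f ζ - lam * c ξ ζ)

/-- `ψ(μ, f, ξ) = μ φ(μ⁻¹, f, ξ)`. -/
def psiGen {Ξ : Type*} (c : Ξ → Ξ → ℝ) (μ : ℝ) (f : Ξ → ℝ) (ξ : Ξ) : ℝ :=
  μ * dualGen c μ⁻¹ f ξ

/-- Real-valued Kullback–Leibler divergence `KL(μ‖ν) = ∫ log (dμ/dν) dμ`. -/
def KLdiv {α : Type*} [MeasurableSpace α] (μ ν : Measure α) : ℝ :=
  ∫ x, Real.log ((μ.rnDeriv ν) x).toReal ∂μ

/-- `m_c = max_ξ E_{ζ∼π₀(·|ξ)}[c(ξ,ζ)]`. -/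
def mC {Ξ : Type*} [MeasurableSpace Ξ] (c : Ξ → Ξ → ℝ) (π0cond : Ξ → Measure Ξ) : ℝ :=
  ⨆ ξ : Ξ, ∫ ζ, c ξ ζ ∂(π0cond ξ)

/-- `m_{2,c} = max_ξ E_{ζ∼π₀(·|ξ)}[c(ξ,ζ)²]`. -/
def m2C {Ξ : Type*} [MeasurableSpace Ξ] (c : Ξ → Ξ → ℝ) (π0cond : Ξ → Measure Ξ) : ℝ :=
  ⨆ ξ : Ξ, ∫ ζ, (c ξ ζ) ^ 2 ∂(π0cond ξ)

/-- The regularized dual generator `φ^{τ,ε}(λ, f, ξ)`. -/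
def phiReg {Ξ : Type*} [MeasurableSpace Ξ] (c : Ξ → Ξ → ℝ) (π0cond : Ξ → Measure Ξ)
    (τ ε lam : ℝ) (f : Ξ → ℝ) (ξ : Ξ) : ℝ :=
  (ε + lam * τ) * Real.log (∫ ζ, Real.exp ((f ζ - lam * c ξ ζ) / (ε + lam * τ)) ∂(π0cond ξ))

/-- `ψ^{τ,ε}(μ, f, ξ) = μ φ^{τ,ε}(μ⁻¹, f, ξ)`. -/
def psiReg {Ξ : Type*} [MeasurableSpace Ξ] (c : Ξ → Ξ → ℝ) (π0cond : Ξ → Measure Ξ)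
    (τ ε μ : ℝ) (f : Ξ → ℝ) (ξ : Ξ) : ℝ :=
  μ * phiReg c π0cond τ ε μ⁻¹ f ξ

/-- The regularized critical radius `ρ_crit^{τ,ε}`. -/
def rhoCritReg {Ξ : Type*} [TopologicalSpace Ξ] [MeasurableSpace Ξ]
    (c : Ξ → Ξ → ℝ) (π0cond : Ξ → Measure Ξ) (τ ε : ℝ) (P : Measure Ξ)
    (F : Set C(Ξ, ℝ)) : ℝ :=
  ⨅ f : F, ∫ ξ,
    ((∫ ζ, (τ / ε * (f : C(Ξ, ℝ)) ζ + c ξ ζ)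
        ∂((π0cond ξ).tilted fun ζ => (f : C(Ξ, ℝ)) ζ / ε))
      - τ * Real.log (∫ ζ, Real.exp ((f : C(Ξ, ℝ)) ζ / ε) ∂(π0cond ξ))) ∂P

/-- The regularized maximal radius `ρ_max^{τ,ε}(λ)`, defined through the derivative in `λ`
of the regularized dual generator. -/
def rhoMaxReg {Ξ : Type*} [TopologicalSpace Ξ] [MeasurableSpace Ξ]
    (c : Ξ → Ξ → ℝ) (π0cond : Ξ → Measure Ξ) (τ ε : ℝ) (P : Measure Ξ)
    (F : Set C(Ξ, ℝ)) (lam : ℝ) : ℝ :=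
  ⨅ f : F, ∫ ξ, -(deriv (fun l => phiReg c π0cond τ ε l (fun ζ => (f : C(Ξ, ℝ)) ζ) ξ) lam) ∂P

/-- The doubly regularized robust risk `R^{τ,ε}_{ρ,Q}(f)`. -/
def regRobustRisk {Ξ : Type*} [MeasurableSpace Ξ] (c : Ξ → Ξ → ℝ) (π0 : Measure (Ξ × Ξ))
    (τ ε ρ : ℝ) (Q : Measure Ξ) (f : Ξ → ℝ) : ℝ :=
  sSup { r | ∃ π : Measure (Ξ × Ξ), IsProbabilityMeasure π ∧ π.map Prod.fst = Q ∧
    π ≪ π0 ∧ Integrable (fun p => Real.log ((π.rnDeriv π0) p).toReal) π ∧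
    (∫ p, c p.1 p.2 ∂π) + τ * KLdiv π π0 ≤ ρ ∧
    r = (∫ p, f p.2 ∂π) - ε * KLdiv π π0 }

/-- The entropy-regularized optimal transport cost `W^τ_c(P, Q)`. -/
def regTransportCost {Ξ : Type*} [MeasurableSpace Ξ] (c : Ξ → Ξ → ℝ) (π0 : Measure (Ξ × Ξ))
    (τ : ℝ) (P Q : Measure Ξ) : ℝ :=
  sInf { r | ∃ π : Measure (Ξ × Ξ), IsProbabilityMeasure π ∧ π.map Prod.fst = P ∧
    π.map Prod.snd = Q ∧ π ≪ π0 ∧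
    Integrable (fun p => Real.log ((π.rnDeriv π0) p).toReal) π ∧
    r = (∫ p, c p.1 p.2 ∂π) + τ * KLdiv π π0 }

lemma integral_le_of_forall_le {α : Type*} [MeasurableSpace α] (μ : Measure α)
    [IsProbabilityMeasure μ] {g : α → ℝ} {M : ℝ} (hM : 0 ≤ M) (h : ∀ x, g x ≤ M) :
    ∫ x, g x ∂μ ≤ M := by
  by_cases hg : Integrable g μ
  · simpa using integral_mono hg (integrable_const M) h
  · rwa [integral_undef hg]

lemma neg_le_integral_of_forall_neg_le {α : Type*} [MeasurableSpace α] (μ : Measure α)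
    [IsProbabilityMeasure μ] {g : α → ℝ} {M : ℝ} (hM : 0 ≤ M) (h : ∀ x, -M ≤ g x) :
    -M ≤ ∫ x, g x ∂μ := by
  have := integral_le_of_forall_le μ (g := fun x => -g x) hM fun x => neg_le.mp (h x)
  rw [integral_neg] at this
  linarith

lemma norm_le_supNormF {Ξ : Type*} [TopologicalSpace Ξ] [CompactSpace Ξ]
    {F : Set C(Ξ, ℝ)} (hF : IsCompact F) {f : C(Ξ, ℝ)} (hf : f ∈ F) : ‖f‖ ≤ supNormF F := by
  have hb : BddAbove (range fun g : F => ‖(g : C(Ξ, ℝ))‖) := by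
    obtain ⟨M, hM⟩ := hF.isBounded.exists_norm_le
    exact ⟨M, by rintro _ ⟨g, rfl⟩; exact hM g g.2⟩
  exact le_ciSup hb ⟨f, hf⟩

lemma mC_nonneg {Ξ : Type*} [MeasurableSpace Ξ] {c : Ξ → Ξ → ℝ}
    (hc_nonneg : ∀ ξ ζ, 0 ≤ c ξ ζ) (κ : Ξ → Measure Ξ) : 0 ≤ mC c κ :=
  Real.iSup_nonneg fun ξ => integral_nonneg (hc_nonneg ξ)

section CompactSpace

variable {Ξ : Type*} [TopologicalSpace Ξ] [CompactSpace Ξ] [MeasurableSpace Ξ]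

lemma integral_cost_le_mC (c : Ξ → Ξ → ℝ) (hc : Continuous fun p : Ξ × Ξ => c p.1 p.2)
    (hc_nonneg : ∀ ξ ζ, 0 ≤ c ξ ζ) (κ : Ξ → Measure Ξ) [∀ ξ, IsProbabilityMeasure (κ ξ)]
    (ξ : Ξ) : ∫ ζ, c ξ ζ ∂(κ ξ) ≤ mC c κ := by
  have hb : BddAbove (range fun ξ => ∫ ζ, c ξ ζ ∂(κ ξ)) := by
    obtain ⟨C, hC⟩ := (isCompact_range hc).bddAbove
    refine ⟨C, ?_⟩
    rintro _ ⟨ξ, rfl⟩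
    have hle : ∀ ζ, c ξ ζ ≤ C := fun ζ => hC ⟨(ξ, ζ), rfl⟩
    exact integral_le_of_forall_le _ ((hc_nonneg ξ ξ).trans (hle ξ)) hle
  exact le_ciSup hb ξ

variable [OpensMeasurableSpace Ξ]

lemma Continuous.integrable_of_compactSpace (μ : Measure Ξ) [IsFiniteMeasure μ] {g : Ξ → ℝ}
    (hg : Continuous g) : Integrable g μ :=
  hg.integrable_of_hasCompactSupport (HasCompactSupport.of_compactSpace g)

lemma integral_le_log_integral_exp (μ : Measure Ξ) [IsProbabilityMeasure μ] {g : Ξ → ℝ}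
    (hg : Continuous g) : ∫ x, g x ∂μ ≤ Real.log (∫ x, Real.exp (g x) ∂μ) := by
  have he := (Real.continuous_exp.comp hg).integrable_of_compactSpace μ
  have hJ := convexOn_exp.map_integral_le (μ := μ) Real.continuous_exp.continuousOn isClosed_univ
    (ae_of_all _ fun _ => mem_univ _) (hg.integrable_of_compactSpace μ) he
  exact (Real.le_log_iff_exp_le ((Real.exp_pos _).trans_le hJ)).mpr hJ

lemma log_integral_exp_le (μ : Measure Ξ) [IsProbabilityMeasure μ] {g : Ξ → ℝ}
    (hg : Continuous g) {M : ℝ} (hM : ∀ x, g x ≤ M) :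
    Real.log (∫ x, Real.exp (g x) ∂μ) ≤ M := by
  rw [Real.log_le_iff_le_exp
    (integral_exp_pos ((Real.continuous_exp.comp hg).integrable_of_compactSpace μ))]
  exact integral_le_of_forall_le μ (Real.exp_pos M).le fun x => Real.exp_le_exp.mpr (hM x)

variable {c : Ξ → Ξ → ℝ} (κ : Ξ → Measure Ξ) [∀ ξ, IsProbabilityMeasure (κ ξ)] {τ ε : ℝ}

lemma phiReg_zero_le (hε : 0 < ε) (f : C(Ξ, ℝ)) (ξ : Ξ) : phiReg c κ τ ε 0 f ξ ≤ ‖f‖ := by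
  have h := log_integral_exp_le (κ ξ) (g := fun ζ => f ζ / ε) (by fun_prop) (M := ‖f‖ / ε)
    fun ζ => by gcongr; exact (le_abs_self _).trans (f.norm_coe_le_norm ζ)
  simpa [phiReg, mul_comm] using (le_div_iff₀ hε).mp h

lemma neg_le_phiReg (hc : Continuous fun p : Ξ × Ξ => c p.1 p.2)
    (hc_nonneg : ∀ ξ ζ, 0 ≤ c ξ ζ) (hτ : 0 ≤ τ) (hε : 0 < ε) {lam : ℝ} (hlam : 0 ≤ lam)
    (f : C(Ξ, ℝ)) (ξ : Ξ) : -(‖f‖ + lam * mC c κ) ≤ phiReg c κ τ ε lam f ξ := by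
  have hs : 0 < ε + lam * τ := by positivity
  have hcξ : Continuous (c ξ) := hc.comp (Continuous.prodMk_right ξ)
  have hJ := integral_le_log_integral_exp (κ ξ)
    (g := fun ζ => (f ζ - lam * c ξ ζ) / (ε + lam * τ)) (by fun_prop)
  rw [integral_div, integral_sub (f.continuous.integrable_of_compactSpace _)
    ((hcξ.integrable_of_compactSpace _).const_mul lam), integral_const_mul, div_le_iff₀' hs] at hJ
  have hf := neg_le_integral_of_forall_neg_le (κ ξ) (norm_nonneg f)
    fun ζ => neg_le_of_abs_le (f.norm_coe_le_norm ζ)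
  have hm := mul_le_mul_of_nonneg_left (integral_cost_le_mC c hc hc_nonneg κ ξ) hlam
  unfold phiReg
  linarith

end CompactSpace

/-- **Dual upper bound for the regularized problem** (Lemma 4.4 / Lemma D.4). -/
theorem dual_upper_bound_reg
    {Ξ : Type*} [MetricSpace Ξ] [CompactSpace Ξ] [Nonempty Ξ]
    [MeasurableSpace Ξ] [BorelSpace Ξ]
    (c : Ξ → Ξ → ℝ)
    (hc_cont : Continuous fun p : Ξ × Ξ => c p.1 p.2)
    (hc_nonneg : ∀ ξ ζ, 0 ≤ c ξ ζ)
    (hc_zero : ∀ ξ ζ, c ξ ζ = 0 ↔ ξ = ζ)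
    (F : Set C(Ξ, ℝ)) (hFcomp : IsCompact F)
    (τ ε : ℝ) (hτ : 0 ≤ τ) (hε : 0 < ε)
    (π0cond : Ξ → Measure Ξ) (hcond : ∀ ξ, IsProbabilityMeasure (π0cond ξ))
    (Q : Measure Ξ) [IsProbabilityMeasure Q]
    (ρ : ℝ) (hρ : mC c π0cond < ρ)
    (lamUp : ℝ) (hup : lamUp = 2 * supNormF F / (ρ - mC c π0cond)) :
    ∀ f ∈ F,
      sInf ((fun lam => lam * ρ + ∫ ξ, phiReg c π0cond τ ε lam (⇑f) ξ ∂Q) '' Ici (0 : ℝ)) =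
      sInf ((fun lam => lam * ρ + ∫ ξ, phiReg c π0cond τ ε lam (⇑f) ξ ∂Q) ''
        Ico (0 : ℝ) lamUp) := by
  intro f hf
  set h : ℝ → ℝ := fun lam => lam * ρ + ∫ ξ, phiReg c π0cond τ ε lam (⇑f) ξ ∂Q with hh
  have hm := mC_nonneg hc_nonneg π0cond
  have hd : 0 < ρ - mC c π0cond := sub_pos.mpr hρ
  have hfF : ‖f‖ ≤ supNormF F := norm_le_supNormF hFcomp hf
  have hF0 : 0 ≤ supNormF F := (norm_nonneg f).trans hfF
  have hzero : h 0 ≤ supNormF F := by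
    simpa [hh] using integral_le_of_forall_le Q hF0
      fun ξ => (phiReg_zero_le π0cond hε f ξ).trans hfF
  have hlow : ∀ lam, 0 ≤ lam → lam * (ρ - mC c π0cond) - supNormF F ≤ h lam := by
    intro lam hlam
    have := neg_le_integral_of_forall_neg_le Q (by positivity : 0 ≤ ‖f‖ + lam * mC c π0cond)
      fun ξ => neg_le_phiReg π0cond hc_cont hc_nonneg hτ hε hlam f ξ
    simp only [hh]
    linarith
  have hzero_le : ∀ lam, lamUp ≤ lam → 0 ≤ lam → h 0 ≤ h lam := by
    intro lam hle hlam
    rw [hup, div_le_iff₀ hd] at hle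
    linarith [hlow lam hlam]
  have hbdd : BddBelow (h '' Ici 0) := by
    refine ⟨-supNormF F, ?_⟩
    rintro _ ⟨lam, hlam, rfl⟩
    linarith [hlow lam hlam, mul_nonneg (mem_Ici.mp hlam) hd.le]
  rcases hF0.eq_or_lt with hF | hF
  · have hup0 : lamUp = 0 := by simp [hup, ← hF]
    have hmin : ∀ lam, 0 ≤ lam → h 0 ≤ h lam := fun lam hlam =>
      hzero_le lam (hup0.le.trans hlam) hlam
    have hleast : IsLeast (h '' Ici 0) (h 0) :=
      ⟨mem_image_of_mem h self_mem_Ici, by rintro _ ⟨lam, hlam, rfl⟩; exact hmin lam hlam⟩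
    rw [hleast.csInf_eq, hup0, Ico_self, image_empty, Real.sInf_empty]
    linarith [hlow 0 le_rfl]
  · have hup_pos : 0 < lamUp := by rw [hup]; positivity
    have h0 : h 0 ∈ h '' Ico 0 lamUp := mem_image_of_mem h ⟨le_rfl, hup_pos⟩
    have hsub : h '' Ico 0 lamUp ⊆ h '' Ici 0 := image_mono Ico_subset_Ici_self
    refine le_antisymm (csInf_le_csInf hbdd ⟨_, h0⟩ hsub) (le_csInf ⟨_, hsub h0⟩ ?_)
    rintro _ ⟨lam, hlam, rfl⟩
    have hbdd' := hbdd.mono hsub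
    rcases lt_or_ge lam lamUp with hlt | hge
    · exact csInf_le hbdd' (mem_image_of_mem h ⟨hlam, hlt⟩)
    · exact (csInf_le hbdd' h0).trans (hzero_le lam hge hlam)
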